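/- arXiv:2503.21128 — 5 statements merged into one kernel-verified Lean document; each statement's English description precedes it below -/
import Mathlib

section
/- Let (x₁, x₂) jointly follow an m-squared-family density p(x|θ) = ‖Θψ(x)‖₂²/z(θ) with respect to μ, where the base measure factors as μ(dx) = μ₁(dx₁|x₂)μ₂(dx₂), and define ψ_{1|2}(x₁) = ψ((x₁, x₂)) for fixed x₂. Then the conditional density of x₁ given x₂ with respect to μ₁(·|x₂) is itself an m-squared-family density: it equals ‖Θψ_{1|2}(x₁)‖₂² / Tr(ΘᵀΘ K_{μ₁(·|x₂), ψ_{1|2}}), where K_{μ₁(·|x₂), ψ_{1|2}} = ∫ ψ_{1|2}(x₁)ψ_{1|2}(x₁)ᵀ μ₁(dx₁|x₂). -/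
open MeasureTheory Matrix ProbabilityTheory

/-- The squared Euclidean norm of `Θ v` as a quadratic form in the Gram matrix `ΘᵀΘ`. -/
lemma sum_sq_mulVec_eq_sum_gram {m n : ℕ} (Θ : Matrix (Fin m) (Fin n) ℝ) (v : Fin n → ℝ) :
    ∑ i, (Θ.mulVec v i) ^ 2 = ∑ j, ∑ k, (Θᵀ * Θ) j k * (v k * v j) := by
  simp only [Matrix.mulVec, dotProduct, Matrix.mul_apply, Matrix.transpose_apply, sq,
    Finset.sum_mul, Finset.mul_sum]
  rw [Finset.sum_comm]
  refine Finset.sum_congr rfl fun j _ => ?_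
  rw [Finset.sum_comm]
  refine Finset.sum_congr rfl fun k _ => Finset.sum_congr rfl fun i _ => ?_
  ring

/-- The integral of `‖Θ f‖²` is the trace of the Gram matrix `ΘᵀΘ` against the second-moment
matrix of `f`. -/
lemma integral_sum_sq_mulVec_eq_trace {m n : ℕ} {X : Type*} [MeasurableSpace X]
    (ν : Measure X) (Θ : Matrix (Fin m) (Fin n) ℝ) (f : X → Fin n → ℝ)
    (hf : ∀ i j, Integrable (fun x => f x i * f x j) ν) :
    ∫ x, ∑ i, (Θ.mulVec (f x) i) ^ 2 ∂ν =
      (Θᵀ * Θ * Matrix.of fun i j => ∫ x, f x i * f x j ∂ν).trace := by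
  simp only [sum_sq_mulVec_eq_sum_gram]
  have h_int (j k : Fin n) : Integrable (fun x => (Θᵀ * Θ) j k * (f x k * f x j)) ν :=
    (hf k j).const_mul _
  refine (integral_finsetSum _ fun j _ => integrable_finsetSum _ fun k _ => h_int j k).trans ?_
  simp only [Matrix.trace, Matrix.diag_apply]
  refine Finset.sum_congr rfl fun j _ => ?_
  rw [integral_finsetSum _ fun k _ => h_int j k, Matrix.mul_apply]
  simp only [integral_const_mul, Matrix.of_apply]

/-- If `(x₁, x₂)` jointly follows an m-squared-family density with base
measure disintegrating as `μ(dx) = μ₁(dx₁|x₂) μ₂(dx₂)`, then the conditional density of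
`x₁` given `x₂` (joint density divided by the marginal density of `x₂`) is again an
m-squared-family density: `‖Θψ₁₂(x₁)‖₂² / Tr(ΘᵀΘ K_{μ₁(·|x₂), ψ₁₂})`. -/
theorem stmt_4 {m n : ℕ} {X₁ X₂ : Type*} [MeasurableSpace X₁] [MeasurableSpace X₂]
    (μ : Measure (X₁ × X₂)) (μ₂ : Measure X₂) [SFinite μ₂]
    (κ : Kernel X₂ X₁) [IsSFiniteKernel κ]
    (hdis : μ = (μ₂.compProd κ).map Prod.swap)
    (ψ : X₁ × X₂ → Fin n → ℝ) (hψ : Measurable ψ)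
    (Θ : Matrix (Fin m) (Fin n) ℝ)
    (z : ℝ) (hzdef : z = ∫ x, ∑ i, (Θ.mulVec (ψ x) i) ^ 2 ∂μ)
    (hzInt : Integrable (fun x => ∑ i, (Θ.mulVec (ψ x) i) ^ 2) μ)
    (hz : 0 < z)
    (x₂ : X₂)
    (hIntc : ∀ i j, Integrable (fun x₁ => ψ (x₁, x₂) i * ψ (x₁, x₂) j) (κ x₂))
    (Kc : Matrix (Fin n) (Fin n) ℝ)
    (hKc : Kc = Matrix.of fun i j => ∫ x₁, ψ (x₁, x₂) i * ψ (x₁, x₂) j ∂(κ x₂)) :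
    ∀ x₁ : X₁,
      ((∑ i, (Θ.mulVec (ψ (x₁, x₂)) i) ^ 2) / z) /
        (∫ y₁, (∑ i, (Θ.mulVec (ψ (y₁, x₂)) i) ^ 2) / z ∂(κ x₂)) =
      (∑ i, (Θ.mulVec (ψ (x₁, x₂)) i) ^ 2) / (Θᵀ * Θ * Kc).trace := by
  intro x₁
  rw [integral_div, integral_sum_sq_mulVec_eq_trace (κ x₂) Θ (fun y => ψ (y, x₂)) hIntc, ← hKc]
  exact div_div_div_cancel_right₀ hz.ne' _ _
end

section
/- Consider a g-family density p₁(x|θ) = g(θᵀψ(x))/z(θ) with g : ℝ → (0,∞) continuously differentiable, ∇z(θ) = ∫_X ψ(x)g'(θᵀψ(x)) μ(dx) (differentiation under the integral sign valid, all integrals finite), and let p₂(a|θ) be the Gaussian density with mean log z(θ) and variance σ² > 0. Then the Fisher information of the dimension-augmented density p₁(x|θ)p₂(a|θ) on X × ℝ (with respect to μ ⊗ Lebesgue) equals ∫_X ψ(x)ψ(x)ᵀ (g'(θᵀψ(x))²/g(θᵀψ(x))²) p₁(x|θ) μ(dx) + ((σ^{−2} − 1)/z(θ)²) ∇z(θ)∇z(θ)ᵀ.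 -/
open MeasureTheory
open scoped RealInnerProductSpace

/-- Integrability against a nondegenerate Gaussian is integrability against its density. -/
theorem integrable_gaussianReal_iff {m : ℝ} {v : NNReal} (hv : v ≠ 0) {f : ℝ → ℝ} :
    Integrable f (ProbabilityTheory.gaussianReal m v) ↔
      Integrable (fun a => f a * ProbabilityTheory.gaussianPDFReal m v a) := by
  rw [ProbabilityTheory.gaussianReal_of_var_ne_zero _ hv,
    integrable_withDensity_iff (ProbabilityTheory.measurable_gaussianPDF _ _)
      (ae_of_all _ fun _ => ProbabilityTheory.gaussianPDF_lt_top)]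
  simp only [ProbabilityTheory.toReal_gaussianPDF]

theorem integral_mul_gaussianPDFReal {m : ℝ} {v : NNReal} (hv : v ≠ 0) (f : ℝ → ℝ) :
    ∫ a, f a * ProbabilityTheory.gaussianPDFReal m v a =
      ∫ a, f a ∂ProbabilityTheory.gaussianReal m v := by
  rw [ProbabilityTheory.integral_gaussianReal_eq_integral_smul hv]
  simp only [smul_eq_mul, mul_comm]

theorem integrable_sub_gaussianReal (m : ℝ) (v : NNReal) (c : ℝ) :
    Integrable (fun a => a - c) (ProbabilityTheory.gaussianReal m v) :=
  ((ProbabilityTheory.memLp_id_gaussianReal' 1 (by simp)).integrable le_rfl).sub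
    (integrable_const c)

theorem integrable_sub_sq_gaussianReal (m : ℝ) (v : NNReal) (c : ℝ) :
    Integrable (fun a => (a - c) ^ 2) (ProbabilityTheory.gaussianReal m v) :=
  ((ProbabilityTheory.memLp_id_gaussianReal' 2 (by simp)).sub (memLp_const c)).integrable_sq

theorem integral_sub_mean_gaussianReal (m : ℝ) (v : NNReal) :
    ∫ a, (a - m) ∂ProbabilityTheory.gaussianReal m v = 0 := by
  have h : Integrable (fun a : ℝ => a) (ProbabilityTheory.gaussianReal m v) :=
    (ProbabilityTheory.memLp_id_gaussianReal' 1 (by simp)).integrable le_rfl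
  rw [integral_sub h (integrable_const m), ProbabilityTheory.integral_id_gaussianReal]
  simp

theorem integral_sub_mean_sq_gaussianReal (m : ℝ) (v : NNReal) :
    ∫ a, (a - m) ^ 2 ∂ProbabilityTheory.gaussianReal m v = v := by
  rw [← ProbabilityTheory.variance_fun_id_gaussianReal (μ := m) (v := v),
    ProbabilityTheory.variance_eq_integral aemeasurable_id',
    ProbabilityTheory.integral_id_gaussianReal]

/-- The score `t ↦ (t - m) / v - 1` has mean `-1` under the Gaussian with mean `m` and
variance `v`. -/
theorem integral_score_gaussianReal (m : ℝ) (v : NNReal) :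
    ∫ a, ((a - m) / (v : ℝ) - 1) ∂ProbabilityTheory.gaussianReal m v = -1 := by
  rw [integral_sub ((integrable_sub_gaussianReal m v m).div_const _) (integrable_const 1),
    integral_div, integral_sub_mean_gaussianReal]
  simp

theorem integrable_score_sq_gaussianReal (m : ℝ) (v : NNReal) :
    Integrable (fun a => ((a - m) / (v : ℝ) - 1) ^ 2) (ProbabilityTheory.gaussianReal m v) := by
  have h := ((((ProbabilityTheory.memLp_id_gaussianReal' (μ := m) (v := v) 2 (by simp)).sub
    (memLp_const m)).mul_const (v : ℝ)⁻¹).sub (memLp_const 1)).integrable_sq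
  simpa [div_eq_mul_inv] using h

theorem integral_score_sq_gaussianReal (m : ℝ) {v : NNReal} (hv : v ≠ 0) :
    ∫ a, ((a - m) / (v : ℝ) - 1) ^ 2 ∂ProbabilityTheory.gaussianReal m v = 1 / (v : ℝ) + 1 := by
  have hv' : (v : ℝ) ≠ 0 := by exact_mod_cast hv
  have h1 := (integrable_sub_sq_gaussianReal m v m).div_const ((v : ℝ) ^ 2)
  have h2 := (integrable_sub_gaussianReal m v m).const_mul (2 / (v : ℝ))
  have h3 : (fun a : ℝ => ((a - m) / v - 1) ^ 2) =
      fun a => (a - m) ^ 2 / (v : ℝ) ^ 2 - 2 / (v : ℝ) * (a - m) + 1 := by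
    funext a
    ring
  have h12 : Integrable (fun a : ℝ => (a - m) ^ 2 / (v : ℝ) ^ 2 - 2 / (v : ℝ) * (a - m))
      (ProbabilityTheory.gaussianReal m v) := h1.sub h2
  rw [h3, integral_add h12 (integrable_const 1), integral_sub h1 h2, integral_div,
    integral_const_mul, integral_sub_mean_gaussianReal, integral_sub_mean_sq_gaussianReal]
  simp
  field_simp

/-- The score of `v ↦ (g ⟪v, w⟫ / z v) * K * exp (-(a - log (z v))² / (2 s))`. -/
theorem hasGradientAt_log_augmented_density {E : Type*} [NormedAddCommGroup E]
    [InnerProductSpace ℝ E] [CompleteSpace E] {g : ℝ → ℝ} {z : E → ℝ} {θ w gz : E} {g' : ℝ}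
    (hgpos : ∀ a, 0 < g a) (hg : HasDerivAt g g' ⟪θ, w⟫) (hz : 0 < z θ)
    (hgrad : HasGradientAt z gz θ) {K : ℝ} (hK : 0 < K) (a s : ℝ) :
    HasGradientAt
      (fun v => Real.log ((g ⟪v, w⟫ / z v) *
        (K * Real.exp (-(a - Real.log (z v)) ^ 2 / (2 * s)))))
      ((g' / g ⟪θ, w⟫) • w + (((a - Real.log (z θ)) / s - 1) * (z θ)⁻¹) • gz) θ := by
  have hzf := hgrad.hasFDerivAt
  have hlogz := hzf.log hz.ne'
  have hin : HasFDerivAt (fun v : E => ⟪v, w⟫) (innerSL ℝ w) θ := by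
    simp only [real_inner_comm]
    exact (innerSL ℝ w).hasFDerivAt
  have hlogg := (hg.comp_hasFDerivAt θ hin).log (hgpos _).ne'
  have hquad := (((hlogz.const_sub a).pow 2).mul_const (-(2 * s)⁻¹)).const_add (Real.log K)
  have hsum := (hlogg.sub hlogz).add hquad
  rw [hasGradientAt_iff_hasFDerivAt]
  refine (hsum.congr_of_eventuallyEq ?_).congr_fderiv ?_
  · filter_upwards [hzf.continuousAt.eventually (lt_mem_nhds hz)] with v hv
    rw [Real.log_mul (div_pos (hgpos _) hv).ne' (by positivity),
      Real.log_div (hgpos _).ne' hv.ne', Real.log_mul hK.ne' (Real.exp_pos _).ne', Real.log_exp]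
    simp only [Function.comp_apply, Pi.add_apply, Pi.sub_apply]
    ring
  · ext u
    simp
    ring

open scoped RealInnerProductSpace

/-- For a g-family density `p₁(x|θ) = g(θᵀψ(x))/z(θ)` (`g > 0` continuously
differentiable, differentiation under the integral sign valid) and the Gaussian density
`p₂(a|θ)` with mean `log z(θ)` and variance `σ² > 0`, the Fisher information of the
dimension-augmented density `p₁ p₂` on `X × ℝ` equals
`∫ ψψᵀ (g'²/g²) p₁ dμ + ((σ⁻² − 1)/z(θ)²) ∇z(θ)∇z(θ)ᵀ`. -/
theorem stmt_11 {n : ℕ} {X : Type*} [MeasurableSpace X] (μ : Measure X) [SigmaFinite μ]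
    (ψ : X → EuclideanSpace ℝ (Fin n)) (hψ : Measurable ψ)
    (g : ℝ → ℝ) (hgpos : ∀ a, 0 < g a) (hg1 : ContDiff ℝ 1 g)
    (σ : ℝ) (hσ : 0 < σ)
    (z : EuclideanSpace ℝ (Fin n) → ℝ)
    (hzdef : z = fun v => ∫ x, g ⟪v, ψ x⟫ ∂μ)
    (θ : EuclideanSpace ℝ (Fin n)) (hz : 0 < z θ)
    (hIntg : Integrable (fun x => g ⟪θ, ψ x⟫) μ)
    (gz : EuclideanSpace ℝ (Fin n))
    (hgzdef : gz = ∫ x, deriv g ⟪θ, ψ x⟫ • ψ x ∂μ)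
    (hIntgz : Integrable (fun x => deriv g ⟪θ, ψ x⟫ • ψ x) μ)
    (hgrad : HasGradientAt z gz θ)
    (hIntF : ∀ i j, Integrable (fun x => ψ x i * ψ x j *
      ((deriv g ⟪θ, ψ x⟫) ^ 2 / (g ⟪θ, ψ x⟫) ^ 2) * (g ⟪θ, ψ x⟫ / z θ)) μ)
    (p₂ : ℝ → EuclideanSpace ℝ (Fin n) → ℝ)
    (hp₂ : p₂ = fun a v => (Real.sqrt (2 * Real.pi * σ ^ 2))⁻¹ *
      Real.exp (-(a - Real.log (z v)) ^ 2 / (2 * σ ^ 2))) :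
    ∀ i j : Fin n,
      (∫ y : X × ℝ,
        (gradient (fun v => Real.log ((g ⟪v, ψ y.1⟫ / z v) * p₂ y.2 v)) θ) i *
        (gradient (fun v => Real.log ((g ⟪v, ψ y.1⟫ / z v) * p₂ y.2 v)) θ) j *
        ((g ⟪θ, ψ y.1⟫ / z θ) * p₂ y.2 θ) ∂(μ.prod volume)) =
      (∫ x, ψ x i * ψ x j * ((deriv g ⟪θ, ψ x⟫) ^ 2 / (g ⟪θ, ψ x⟫) ^ 2) *
        (g ⟪θ, ψ x⟫ / z θ) ∂μ) + ((1 / σ ^ 2 - 1) / (z θ) ^ 2) * (gz i * gz j) := by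
  intro i j
  set m := Real.log (z θ)
  let v : NNReal := ⟨σ ^ 2, sq_nonneg σ⟩
  have hv : v ≠ 0 := fun h => (pow_pos hσ 2).ne' (congrArg NNReal.toReal h)
  have hvσ : (v : ℝ) = σ ^ 2 := rfl
  set s : X → ℝ := fun x => deriv g ⟪θ, ψ x⟫ / g ⟪θ, ψ x⟫ with hs
  set p : X → ℝ := fun x => g ⟪θ, ψ x⟫ / z θ with hp
  let q := ProbabilityTheory.gaussianPDFReal m v
  have hq : ∀ a, p₂ a θ = q a := fun a => by rw [hp₂]; rfl
  have hgrad' : ∀ y : X × ℝ,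
      gradient (fun v => Real.log ((g ⟪v, ψ y.1⟫ / z v) * p₂ y.2 v)) θ =
        s y.1 • ψ y.1 + (((y.2 - m) / v - 1) * (z θ)⁻¹) • gz := fun y => by
    rw [hp₂]
    exact (hasGradientAt_log_augmented_density hgpos
      ((hg1.differentiable one_ne_zero) _).hasDerivAt hz hgrad (by positivity) y.2 (σ ^ 2)).gradient
  have hp_int : Integrable p μ := hIntg.div_const _
  have hp_one : ∫ x, p x ∂μ = 1 := by
    rw [hp, integral_div, div_eq_one_iff_eq hz.ne', hzdef]
  have hs_eq : ∀ k x, s x * ψ x k * p x = (deriv g ⟪θ, ψ x⟫ • ψ x) k / z θ := fun k x => by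
    have := (hgpos ⟪θ, ψ x⟫).ne'
    simp only [hs, hp, PiLp.smul_apply, smul_eq_mul]
    field_simp
  have hs_int : ∀ k, Integrable (fun x => s x * ψ x k * p x) μ := fun k => by
    simp only [hs_eq]
    exact ((EuclideanSpace.proj (𝕜 := ℝ) k).integrable_comp hIntgz).div_const _
  have hs_mean : ∀ k, ∫ x, s x * ψ x k * p x ∂μ = gz k / z θ := fun k => by
    simp only [hs_eq]
    rw [integral_div, hgzdef]
    congr 1
    exact (EuclideanSpace.proj (𝕜 := ℝ) k).integral_comp_comm hIntgz
  set A : X → ℝ := fun x => ψ x i * ψ x j *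
    ((deriv g ⟪θ, ψ x⟫) ^ 2 / (g ⟪θ, ψ x⟫) ^ 2) * (g ⟪θ, ψ x⟫ / z θ) with hA
  set B : X → ℝ := fun x =>
    s x * ψ x i * p x * (gz j / z θ) + s x * ψ x j * p x * (gz i / z θ) with hB
  have hB_int : Integrable B μ := ((hs_int i).mul_const _).add ((hs_int j).mul_const _)
  have hB_mean : ∫ x, B x ∂μ = 2 * (gz i / z θ * (gz j / z θ)) := by
    rw [hB, integral_add ((hs_int i).mul_const _) ((hs_int j).mul_const _), integral_mul_const,
      integral_mul_const, hs_mean, hs_mean]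
    ring
  set C : X → ℝ := fun x => p x * (gz i / z θ * (gz j / z θ)) with hC
  have hq1 : Integrable (fun a => ((a - m) / v - 1) * q a) :=
    (integrable_gaussianReal_iff hv).1
      (((integrable_sub_gaussianReal m v m).div_const _).sub (integrable_const 1))
  have hq2 : Integrable (fun a => ((a - m) / v - 1) ^ 2 * q a) :=
    (integrable_gaussianReal_iff hv).1 (integrable_score_sq_gaussianReal m v)
  have hI0 : Integrable (fun y : X × ℝ => A y.1 * q y.2) (μ.prod volume) :=
    (hIntF i j).mul_prod (ProbabilityTheory.integrable_gaussianPDFReal m v)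
  have hI1 := hB_int.mul_prod hq1
  have hI01 : Integrable (fun y : X × ℝ => A y.1 * q y.2 +
      B y.1 * (((y.2 - m) / v - 1) * q y.2)) (μ.prod volume) := hI0.add hI1
  have hI2 : Integrable (fun y : X × ℝ => C y.1 * (((y.2 - m) / v - 1) ^ 2 * q y.2))
      (μ.prod volume) :=
    (hp_int.mul_const (gz i / z θ * (gz j / z θ))).mul_prod hq2
  calc _ = ∫ y : X × ℝ, (A y.1 * q y.2 + B y.1 * (((y.2 - m) / v - 1) * q y.2)) +
          C y.1 * (((y.2 - m) / v - 1) ^ 2 * q y.2) ∂(μ.prod volume) := by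
        refine integral_congr_ae (ae_of_all _ fun y => ?_)
        simp only [hgrad', hq, PiLp.add_apply, PiLp.smul_apply, smul_eq_mul, hA, hB, hC, hs, hp]
        ring
    _ = ∫ x, A x ∂μ + 2 * (gz i / z θ * (gz j / z θ)) * (-1) +
          gz i / z θ * (gz j / z θ) * (1 / v + 1) := by
        rw [integral_add hI01 hI2, integral_add hI0 hI1, integral_prod_mul A q,
          integral_prod_mul B (fun a => ((a - m) / v - 1) * q a),
          integral_prod_mul C (fun a => ((a - m) / v - 1) ^ 2 * q a),
          ProbabilityTheory.integral_gaussianPDFReal_eq_one m hv,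
          integral_mul_gaussianPDFReal hv, integral_mul_gaussianPDFReal hv,
          integral_score_gaussianReal, integral_score_sq_gaussianReal m hv, hB_mean, hC,
          integral_mul_const, hp_one]
        ring
    _ = _ := by
        rw [hvσ]
        ring
end

section
/- Let g be positively homogeneous of order k ≥ 2, i.e. g(a) = |a|^k for a > 0 and g(a) = c|a|^k for a ≤ 0 with c > 0, let 0 < σ^{−2} and σ^{−2} ≥ 1, and suppose that for every pair of vectors θ, θ' ∈ ℝⁿ with θ' not proportional to θ, the set {x ∈ X : θᵀψ(x) ≠ 0 and θ'ᵀψ(x) ≠ 0} has positive μ-measure. Then at every θ with 0 < z(θ) < ∞, the Fisher information of the dimension-augmented family p(x|θ)·N(a | log z(θ), σ²), namely G(θ) = ∫_X ψψᵀ (g'(θᵀψ)²/g(θᵀψ)²) p(x|θ) μ(dx) + ((σ^{−2} − 1)/z(θ)²)∇z(θ)∇z(θ)ᵀ, is strictly positive definite; i.e. the dimension-augmented positively homogeneous family is a regular model. -/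
open MeasureTheory Matrix

/-- The deriv of a function positively homogeneous on each half-line vanishes at most at `0`. -/
theorem deriv_ne_zero_of_posHomogeneous {c k : ℝ} (hc : 0 < c) (hk : 0 < k) {g : ℝ → ℝ}
    (hg : ∀ a : ℝ, (0 < a → g a = |a| ^ k) ∧ (a ≤ 0 → g a = c * |a| ^ k)) {a : ℝ} (ha : a ≠ 0) :
    deriv g a ≠ 0 := by
  rcases ha.lt_or_gt with h | h
  · have he : g =ᶠ[nhds a] fun b => c * (-b) ^ k := by
      filter_upwards [Iio_mem_nhds h] with b hb
      rw [(hg b).2 (le_of_lt hb), abs_of_neg hb]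
    have hd : HasDerivAt (fun b : ℝ => c * (-b) ^ k) (c * (-1 * k * (-a) ^ (k - 1))) a :=
      ((hasDerivAt_neg a).rpow_const (Or.inl (neg_ne_zero.2 ha))).const_mul c
    rw [he.deriv_eq, hd.deriv]
    have := Real.rpow_pos_of_pos (neg_pos.2 h) (k - 1)
    have : 0 < c * (k * (-a) ^ (k - 1)) := by positivity
    linarith
  · have he : g =ᶠ[nhds a] fun b => b ^ k := by
      filter_upwards [Ioi_mem_nhds h] with b hb
      rw [(hg b).1 hb, abs_of_pos hb]
    rw [he.deriv_eq, (Real.hasDerivAt_rpow_const (Or.inl ha)).deriv]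
    have := Real.rpow_pos_of_pos h (k - 1)
    positivity

theorem pos_of_posHomogeneous {c k : ℝ} (hc : 0 < c) {g : ℝ → ℝ}
    (hg : ∀ a : ℝ, (0 < a → g a = |a| ^ k) ∧ (a ≤ 0 → g a = c * |a| ^ k)) {a : ℝ} (ha : a ≠ 0) :
    0 < g a := by
  have h := Real.rpow_pos_of_pos (abs_pos.2 ha) k
  rcases ha.lt_or_gt with h' | h'
  · rw [(hg a).2 h'.le]; positivity
  · rw [(hg a).1 h']; exact h

/-- The weighted second-moment matrix of `ψ` is positive definite as soon as no nonzero linear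
form in `ψ` vanishes almost everywhere on the support of the weight. -/
theorem posDef_integral_mul_mul {ι X : Type*} [Fintype ι] [MeasurableSpace X] {μ : Measure X}
    {ψ : X → ι → ℝ} {w : X → ℝ} (hw : ∀ x, 0 ≤ w x)
    (hint : ∀ i j, Integrable (fun x => ψ x i * ψ x j * w x) μ)
    (hpos : ∀ v : ι → ℝ, v ≠ 0 → 0 < μ {x | w x ≠ 0 ∧ v ⬝ᵥ ψ x ≠ 0}) :
    (Matrix.of fun i j => ∫ x, ψ x i * ψ x j * w x ∂μ).PosDef := by
  refine Matrix.PosDef.of_dotProduct_mulVec_pos ?_ fun v hv => ?_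
  · ext i j
    simp [mul_comm (ψ _ i)]
  · have hexp : (fun x => (v ⬝ᵥ ψ x) ^ 2 * w x) =
        fun x => ∑ i, ∑ j, v i * v j * (ψ x i * ψ x j * w x) := by
      ext x
      rw [sq, dotProduct, Finset.sum_mul_sum, Finset.sum_mul]
      refine Finset.sum_congr rfl fun i _ => ?_
      rw [Finset.sum_mul]
      exact Finset.sum_congr rfl fun j _ => by ring
    have hI : ∀ i j, Integrable (fun x => v i * v j * (ψ x i * ψ x j * w x)) μ :=
      fun i j => (hint i j).const_mul _
    have hI' : Integrable (fun x => (v ⬝ᵥ ψ x) ^ 2 * w x) μ := by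
      rw [hexp]
      exact integrable_finsetSum _ fun i _ => integrable_finsetSum _ fun j _ => hI i j
    have heq : star v ⬝ᵥ (Matrix.of fun i j => ∫ x, ψ x i * ψ x j * w x ∂μ) *ᵥ v =
        ∫ x, (v ⬝ᵥ ψ x) ^ 2 * w x ∂μ := by
      rw [hexp, integral_finsetSum _ fun i _ => integrable_finsetSum _ fun j _ => hI i j]
      simp only [dotProduct, mulVec, Matrix.of_apply, Pi.star_apply, star_trivial]
      refine Finset.sum_congr rfl fun i _ => ?_
      rw [integral_finsetSum _ fun j _ => hI i j, Finset.mul_sum]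
      refine Finset.sum_congr rfl fun j _ => ?_
      rw [integral_const_mul]
      ring
    rw [heq, integral_pos_iff_support_of_nonneg (fun x => mul_nonneg (sq_nonneg _) (hw x)) hI']
    refine (hpos v hv).trans_le (measure_mono fun x hx => ?_)
    exact mul_ne_zero (pow_ne_zero 2 hx.2) hx.1

/-- For a positively homogeneous family of order `k ≥ 2`
(`g(a) = |a|^k` for `a > 0`, `g(a) = c|a|^k` for `a ≤ 0`, `c > 0`), with `0 < σ⁻²`,
`σ⁻² ≥ 1`, and assuming that for every pair of non-proportional vectors `θ, θ'` the set
`{x : θᵀψ(x) ≠ 0 ∧ θ'ᵀψ(x) ≠ 0}` has positive measure, the Fisher information of the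
dimension-augmented family,
`G(θ) = ∫ ψψᵀ (g'²/g²) p dμ + ((σ⁻² − 1)/z²) ∇z∇zᵀ`, is strictly positive definite:
the dimension-augmented positively homogeneous family is a regular model. -/
theorem stmt_12 {n : ℕ} {X : Type*} [MeasurableSpace X] (μ : Measure X)
    (ψ : X → Fin n → ℝ) (hψ : Measurable ψ)
    (c k : ℝ) (hc : 0 < c) (hk : 2 ≤ k)
    (g : ℝ → ℝ)
    (hg : ∀ a : ℝ, (0 < a → g a = |a| ^ k) ∧ (a ≤ 0 → g a = c * |a| ^ k))
    (σ : ℝ) (hσpos : 0 < 1 / σ ^ 2) (hσ1 : 1 ≤ 1 / σ ^ 2)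
    (hreg : ∀ θ θ' : Fin n → ℝ, LinearIndependent ℝ ![θ, θ'] →
      0 < μ {x | θ ⬝ᵥ ψ x ≠ 0 ∧ θ' ⬝ᵥ ψ x ≠ 0})
    (θ : Fin n → ℝ) (z : ℝ) (hzdef : z = ∫ x, g (θ ⬝ᵥ ψ x) ∂μ)
    (hzInt : Integrable (fun x => g (θ ⬝ᵥ ψ x)) μ) (hz : 0 < z)
    (gz : Fin n → ℝ) (hgzdef : gz = ∫ x, deriv g (θ ⬝ᵥ ψ x) • ψ x ∂μ)
    (hgzInt : Integrable (fun x => deriv g (θ ⬝ᵥ ψ x) • ψ x) μ)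
    (hIntF : ∀ i j, Integrable (fun x => ψ x i * ψ x j *
      ((deriv g (θ ⬝ᵥ ψ x)) ^ 2 / (g (θ ⬝ᵥ ψ x)) ^ 2) * (g (θ ⬝ᵥ ψ x) / z)) μ) :
    (Matrix.of fun i j =>
      (∫ x, ψ x i * ψ x j * ((deriv g (θ ⬝ᵥ ψ x)) ^ 2 / (g (θ ⬝ᵥ ψ x)) ^ 2) *
        (g (θ ⬝ᵥ ψ x) / z) ∂μ) +
      ((1 / σ ^ 2 - 1) / z ^ 2) * (gz i * gz j)).PosDef := by
  have hk0 : 0 < k := by linarith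
  have hg0 : g 0 = 0 := by simp [(hg 0).2 le_rfl, Real.zero_rpow hk0.ne']
  have hgnn : ∀ a, 0 ≤ g a := fun a => by
    rcases eq_or_ne a 0 with rfl | ha
    · exact hg0.ge
    · exact (pos_of_posHomogeneous hc hg ha).le
  have hsupp : 0 < μ {x | θ ⬝ᵥ ψ x ≠ 0} := by
    refine ((integral_pos_iff_support_of_nonneg (fun x => hgnn _) hzInt).1 (hzdef ▸ hz)).trans_le
      (measure_mono fun x hx h => hx ?_)
    simp [h, hg0]
  have hθ : θ ≠ 0 := by
    rintro rfl
    simp at hsupp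
  set w : X → ℝ := fun x =>
    (deriv g (θ ⬝ᵥ ψ x)) ^ 2 / (g (θ ⬝ᵥ ψ x)) ^ 2 * (g (θ ⬝ᵥ ψ x) / z) with hw
  have hw0 : ∀ x, 0 ≤ w x := fun x =>
    mul_nonneg (by positivity) (div_nonneg (hgnn _) hz.le)
  have hwne : ∀ x, θ ⬝ᵥ ψ x ≠ 0 → w x ≠ 0 := fun x hx => by
    have h1 := deriv_ne_zero_of_posHomogeneous hc hk0 hg hx
    have h2 := pos_of_posHomogeneous hc hg hx
    have := hz.ne'
    positivity
  have hA : (Matrix.of fun i j => ∫ x, ψ x i * ψ x j * w x ∂μ).PosDef := by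
    refine posDef_integral_mul_mul hw0 (fun i j => by simpa only [hw, mul_assoc] using hIntF i j)
      fun v hv => ?_
    suffices h : 0 < μ {x | θ ⬝ᵥ ψ x ≠ 0 ∧ v ⬝ᵥ ψ x ≠ 0} from
      h.trans_le (measure_mono fun x hx => ⟨hwne x hx.1, hx.2⟩)
    by_cases hli : LinearIndependent ℝ ![θ, v]
    · exact hreg θ v hli
    · obtain ⟨t, rfl⟩ : ∃ t : ℝ, t • θ = v := by
        simpa [LinearIndependent.pair_iff' hθ] using hli
      have ht : t ≠ 0 := fun h => hv (by simp [h])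
      simpa [ht] using hsupp
  have hB : (((1 / σ ^ 2 - 1) / z ^ 2) • vecMulVec gz (star gz)).PosSemidef :=
    (posSemidef_vecMulVec_self_star gz).smul (div_nonneg (sub_nonneg.2 hσ1) (sq_nonneg z))
  convert hA.add_posSemidef hB using 1
  ext i j
  simp [hw, vecMulVec_apply, mul_assoc]
end

section
/- Let c > 0 and k ≥ 2 be real numbers and define g : ℝ → [0,∞) by g(a) = |a|^k for a > 0 and g(a) = c|a|^k for a ≤ 0. If g is infinitely differentiable on ℝ, then c = 1 and k is an even positive integer; that is, the only infinitely differentiable positively homogeneous families are the even-order monomial families g(a) = a^k with k ∈ {2, 4, 6, …}. -/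
open Filter Topology in
/-- A function that is continuous at `0` cannot agree with a nonzero multiple of a negative
power on the positive half-line. -/
theorem not_continuousAt_zero_of_eq_rpow_neg {f : ℝ → ℝ} {A k : ℝ} (hA : A ≠ 0) (hk : k < 0)
    (hf : ∀ x, 0 < x → f x = A * x ^ k) : ¬ ContinuousAt f 0 := by
  intro hcont
  have hpow : ContinuousAt (fun x : ℝ => x ^ (-k)) 0 :=
    Real.continuousAt_rpow_const 0 (-k) (Or.inr (by linarith))
  have hprod : Tendsto (fun x => f x * x ^ (-k)) (𝓝[>] 0) (𝓝 0) := by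
    have h := (hcont.mul hpow).tendsto.mono_left (nhdsWithin_le_nhds (s := Set.Ioi 0))
    simpa [Real.zero_rpow (neg_ne_zero.mpr hk.ne), Pi.mul_def] using h
  refine hA (tendsto_nhds_unique (Tendsto.congr' ?_ tendsto_const_nhds) hprod)
  filter_upwards [self_mem_nhdsWithin] with x (hx : 0 < x)
  rw [hf x hx, mul_assoc, ← Real.rpow_add hx, add_neg_cancel, Real.rpow_zero, mul_one]

open Filter Topology in
/-- A function that is continuous at `0` and constant on each open half-line takes the same
value on both. -/
theorem eq_of_continuousAt_zero_of_eq_const {f : ℝ → ℝ} {A B : ℝ} (hcont : ContinuousAt f 0)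
    (hpos : ∀ x, 0 < x → f x = A) (hneg : ∀ x, x < 0 → f x = B) : A = B := by
  have hA : Tendsto f (𝓝[>] 0) (𝓝 A) :=
    tendsto_const_nhds.congr' (by
      filter_upwards [self_mem_nhdsWithin] with x hx using (hpos x hx).symm)
  have hB : Tendsto f (𝓝[<] 0) (𝓝 B) :=
    tendsto_const_nhds.congr' (by
      filter_upwards [self_mem_nhdsWithin] with x hx using (hneg x hx).symm)
  exact (tendsto_nhds_unique hA (hcont.tendsto.mono_left nhdsWithin_le_nhds)).trans
    (tendsto_nhds_unique hB (hcont.tendsto.mono_left nhdsWithin_le_nhds)).symm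

open Filter Topology in
/-- A smooth function that is a nonzero multiple of `x ^ k` for `x > 0` and a multiple of
`(-x) ^ k` for `x < 0` is a monomial away from `0`. -/
theorem ContDiff.exists_nat_eq_of_eq_rpow {f : ℝ → ℝ} {A B k : ℝ}
    (hf : ContDiff ℝ (⊤ : ℕ∞) f) (hA : A ≠ 0) (hpos : ∀ x, 0 < x → f x = A * x ^ k)
    (hneg : ∀ x, x < 0 → f x = B * (-x) ^ k) :
    ∃ m : ℕ, k = m ∧ B = (-1) ^ m * A := by
  obtain ⟨n, hn⟩ := exists_nat_gt k
  induction n generalizing f A B k with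
  | zero =>
    exact absurd hf.continuous.continuousAt
      (not_continuousAt_zero_of_eq_rpow_neg hA (by simpa using hn) hpos)
  | succ n ih =>
    rcases lt_trichotomy k 0 with hk | rfl | hk
    · exact absurd hf.continuous.continuousAt (not_continuousAt_zero_of_eq_rpow_neg hA hk hpos)
    · refine ⟨0, by simp, ?_⟩
      simpa using (eq_of_continuousAt_zero_of_eq_const hf.continuous.continuousAt
        (by simpa using hpos) (by simpa using hneg)).symm
    · have hdpos : ∀ x, 0 < x → deriv f x = A * k * x ^ (k - 1) := by
        intro x hx
        have h : f =ᶠ[𝓝 x] fun y => A * y ^ k := by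
          filter_upwards [lt_mem_nhds hx] with y hy using hpos y hy
        rw [h.deriv_eq, mul_assoc]
        exact ((Real.hasDerivAt_rpow_const (Or.inl hx.ne')).const_mul A).deriv
      have hdneg : ∀ x, x < 0 → deriv f x = -(B * k) * (-x) ^ (k - 1) := by
        intro x hx
        have h : f =ᶠ[𝓝 x] fun y => B * (-y) ^ k := by
          filter_upwards [gt_mem_nhds hx] with y hy using hneg y hy
        rw [h.deriv_eq]
        have hd := (((hasDerivAt_id x).neg.rpow_const (p := k)
          (Or.inl (neg_ne_zero.mpr hx.ne))).const_mul B).deriv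
        refine hd.trans ?_
        simp only [id, Pi.neg_apply]
        ring
      obtain ⟨m, hm, hB⟩ := ih (contDiff_infty_iff_deriv.mp hf).2 (mul_ne_zero hA hk.ne')
        hdpos hdneg (by push_cast at hn; linarith)
      refine ⟨m + 1, by push_cast; linarith, mul_right_cancel₀ hk.ne' ?_⟩
      rw [pow_succ]
      linarith

/-- If `g(a) = |a|^k` for `a > 0` and `g(a) = c|a|^k` for `a ≤ 0`
(with `c > 0`, `k ≥ 2` real) is infinitely differentiable on `ℝ`, then `c = 1` and `k` is
an even positive integer: the only infinitely differentiable positively homogeneous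
families are the even-order monomial families. -/
theorem stmt_15 (c k : ℝ) (hc : 0 < c) (hk : 2 ≤ k)
    (g : ℝ → ℝ)
    (hg : ∀ a : ℝ, (0 < a → g a = |a| ^ k) ∧ (a ≤ 0 → g a = c * |a| ^ k))
    (hsmooth : ContDiff ℝ (⊤ : ℕ∞) g) :
    c = 1 ∧ ∃ m : ℕ, 0 < m ∧ Even m ∧ k = (m : ℝ) := by
  obtain ⟨m, hkm, hcm⟩ := hsmooth.exists_nat_eq_of_eq_rpow (A := 1) (B := c) (k := k) one_ne_zero
    (fun x hx => by rw [(hg x).1 hx, abs_of_pos hx, one_mul])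
    (fun x hx => by rw [(hg x).2 hx.le, abs_of_neg hx])
  have hm : 0 < m := by
    have : (0 : ℝ) < m := by linarith
    exact_mod_cast this
  rcases Nat.even_or_odd m with he | ho
  · exact ⟨by simpa [he.neg_one_pow] using hcm, m, hm, he, hkm⟩
  · rw [ho.neg_one_pow] at hcm
    linarith
end

section
/- Let r ∈ ℝ with r ≠ 0 and r ≠ 1, let I ⊆ ℝ be an open interval, and let g : I → (0,∞) be twice continuously differentiable satisfying r·g''(a)·g(a) = g'(a)² for all a ∈ I. Then either g is constant on I, or there exist constants c₁ ∈ ℝ and c₂ > 0 such that ((r−1)/r)·a − c₁ ≠ 0 for all a ∈ I and g(a) = c₂ · |((r−1)/r)·a − c₁|^{r/(r−1)} for all a ∈ I. -/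
/-- If `g > 0` solves `r g'' g = (g')²` on a preconnected open set, then `g ^ ((r - 1) / r)` is
affine there. -/
theorem exists_rpow_eq_affine {r : ℝ} (hr0 : r ≠ 0) {I : Set ℝ} (hI : IsOpen I)
    (hIc : IsPreconnected I) {g : ℝ → ℝ} (hgpos : ∀ a ∈ I, 0 < g a) (hg : ContDiffOn ℝ 2 g I)
    (hode : ∀ a ∈ I, r * deriv (deriv g) a * g a = (deriv g a) ^ 2) :
    ∃ m b : ℝ, ∀ a ∈ I, g a ^ ((r - 1) / r) = m * a + b := by
  have hg1 : ∀ a ∈ I, HasDerivAt g (deriv g a) a := fun a ha =>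
    ((hg.differentiableOn (by norm_num)).differentiableAt (hI.mem_nhds ha)).hasDerivAt
  have hg2 : ∀ a ∈ I, HasDerivAt (deriv g) (deriv (deriv g) a) a := fun a ha =>
    (((hg.deriv_of_isOpen hI (m := 1) (by norm_num)).differentiableOn
      (by norm_num)).differentiableAt (hI.mem_nhds ha)).hasDerivAt
  set α := (r - 1) / r with hα
  have hf : ∀ a ∈ I, HasDerivAt (fun x => g x ^ α) (deriv g a * α * g a ^ (α - 1)) a :=
    fun a ha => (hg1 a ha).rpow_const (Or.inl (hgpos a ha).ne')
  have hf' : ∀ a ∈ I, HasDerivAt (fun x => deriv g x * α * g x ^ (α - 1)) 0 a := by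
    intro a ha
    have hpos := hgpos a ha
    have hpow : g a ^ (α - 1) = g a ^ (α - 1 - 1) * g a := by
      rw [← Real.rpow_add_one hpos.ne', sub_add_cancel]
    have hα1 : α - 1 = -1 / r := by rw [hα]; field_simp; ring
    have key : deriv (deriv g) a * g a + (α - 1) * deriv g a ^ 2 = 0 := by
      rw [hα1, ← hode a ha]; field_simp; ring
    refine (((hg2 a ha).mul_const α).mul
      ((hg1 a ha).rpow_const (p := α - 1) (Or.inl hpos.ne'))).congr_deriv ?_
    rw [hpow]
    linear_combination (α * g a ^ (α - 1 - 1)) * key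
  obtain ⟨m, hm⟩ := hI.exists_is_const_of_deriv_eq_zero hIc
    (fun a ha => (hf' a ha).differentiableAt.differentiableWithinAt)
    (fun a ha => (hf' a ha).deriv)
  obtain ⟨b, hb⟩ := hI.exists_is_const_of_deriv_eq_zero hIc
    (f := fun x => g x ^ α - m * x)
    (fun a ha =>
      ((hf a ha).sub ((hasDerivAt_id a).const_mul m)).differentiableAt.differentiableWithinAt)
    (fun a ha => by
      have h := ((hf a ha).sub ((hasDerivAt_id a).const_mul m)).deriv
      rw [hm a ha, mul_one, sub_self] at h
      exact h)
  exact ⟨m, b, fun a ha => by linear_combination hb a ha⟩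

/-- If `g : I → (0,∞)` is twice continuously differentiable on an open
interval `I` and satisfies the ODE `r g''(a) g(a) = g'(a)²` on `I` (with `r ≠ 0`, `r ≠ 1`),
then either `g` is constant on `I`, or there are constants `c₁ ∈ ℝ` and `c₂ > 0` with
`((r−1)/r)·a − c₁ ≠ 0` on `I` and `g(a) = c₂ |((r−1)/r)·a − c₁|^{r/(r−1)}` on `I`. -/
theorem stmt_17 (r : ℝ) (hr0 : r ≠ 0) (hr1 : r ≠ 1)
    (I : Set ℝ) (hI : IsOpen I) (hIc : I.OrdConnected)
    (g : ℝ → ℝ) (hgpos : ∀ a ∈ I, 0 < g a)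
    (hg : ContDiffOn ℝ 2 g I)
    (hode : ∀ a ∈ I, r * deriv (deriv g) a * g a = (deriv g a) ^ 2) :
    (∀ a ∈ I, ∀ b ∈ I, g a = g b) ∨
    ∃ c₁ c₂ : ℝ, 0 < c₂ ∧ (∀ a ∈ I, ((r - 1) / r) * a - c₁ ≠ 0) ∧
      ∀ a ∈ I, g a = c₂ * |((r - 1) / r) * a - c₁| ^ (r / (r - 1)) := by
  obtain ⟨m, b, hmb⟩ := exists_rpow_eq_affine hr0 hI hIc.isPreconnected hgpos hg hode
  have hr1' : r - 1 ≠ 0 := sub_ne_zero.mpr hr1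
  have hα : (r - 1) / r ≠ 0 := div_ne_zero hr1' hr0
  have hinv : ((r - 1) / r)⁻¹ = r / (r - 1) := inv_div _ _
  set α := (r - 1) / r
  have hg_eq : ∀ a ∈ I, g a = (m * a + b) ^ (r / (r - 1)) := fun a ha => by
    rw [← hmb a ha, ← hinv, Real.rpow_rpow_inv (hgpos a ha).le hα]
  have hpos : ∀ a ∈ I, 0 < m * a + b := fun a ha =>
    hmb a ha ▸ Real.rpow_pos_of_pos (hgpos a ha) α
  by_cases hm : m = 0
  · left
    intro x hx y hy
    rw [hg_eq x hx, hg_eq y hy, hm, zero_mul, zero_mul]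
  · right
    have hscale : ∀ a, m * a + b = m / α * (α * a - -(α * b / m)) := fun a => by
      field_simp
      ring
    refine ⟨-(α * b / m), |m / α| ^ (r / (r - 1)),
      Real.rpow_pos_of_pos (abs_pos.mpr (div_ne_zero hm hα)) _, fun a ha h => ?_, fun a ha => ?_⟩
    · have := hpos a ha
      rw [hscale, h, mul_zero] at this
      exact this.false
    · rw [← Real.mul_rpow (abs_nonneg _) (abs_nonneg _), ← abs_mul, ← hscale,
        abs_of_pos (hpos a ha), hg_eq a ha]
end
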